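/- arXiv:2501.02117 — 2 statements merged into one kernel-verified Lean document; each statement's English description precedes it below -/
import Mathlib

section
/- Fix m ≥ 1 and let P = I − D^{−1}L(q) be the reversible transition matrix on the friendship graph F_m. Assume the ratio condition: for each i = 1,…,m there is μ_i with μ_i = q_{0,2i−1}/π_{2i−1} = q_{0,2i}/π_{2i}. Then for each i = 1,…,m, the vector u_i = (1/π_{2i−1})·e_{2i−1} − (1/π_{2i})·e_{2i} (where e_j is the j-th standard basis vector of ℝ^{2m+1}) is an eigenvector of P with eigenvalue s̄_i = 1 − μ_i − q_{2i−1,2i}·(π_{2i−1} + π_{2i})/(π_{2i−1}·π_{2i}). -/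
open Matrix Polynomial

/-- The symmetric Laplacian `L(q)` of a weight function `q`:
off-diagonal entry `(i,j)` is `-q i j`, diagonal entry `(i,i)` is `∑_{k ≠ i} q i k`. -/
noncomputable def lap {n : ℕ} (q : Fin n → Fin n → ℝ) : Matrix (Fin n) (Fin n) ℝ :=
  Matrix.of fun i j => if i = j then ∑ k ∈ Finset.univ.erase i, q i k else -(q i j)

/-- The reversible transition matrix `P = I - D⁻¹ L(q)` with `D = diag(pr)`. -/
noncomputable def transP {n : ℕ} (pr : Fin n → ℝ) (q : Fin n → Fin n → ℝ) :
    Matrix (Fin n) (Fin n) ℝ :=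
  1 - (Matrix.diagonal pr)⁻¹ * lap q

/-- A (row-)stochastic matrix: nonnegative entries, each row summing to one. -/
def IsStochastic {n : ℕ} (M : Matrix (Fin n) (Fin n) ℝ) : Prop :=
  (∀ i j, 0 ≤ M i j) ∧ ∀ i, ∑ j, M i j = 1

/-- The second largest eigenvalue modulus: the supremum of `|lam|` over real
eigenvalues `lam` of `M` (roots of the characteristic polynomial, with
multiplicity), after removing one copy of the eigenvalue `1`. -/
noncomputable def slem {n : ℕ} (M : Matrix (Fin n) (Fin n) ℝ) : ℝ :=
  sSup {r : ℝ | ∃ lam ∈ (Matrix.charpoly M).roots.erase 1, r = |lam|}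

/-- Central vertex of the friendship graph `F_m`. -/
def v0 {m : ℕ} : Fin (2*m+1) := ⟨0, by omega⟩
/-- Vertex `2i-1` (first friend of blade `i`, with `i` running over `Fin m`). -/
def v1 {m : ℕ} (i : Fin m) : Fin (2*m+1) := ⟨2*(i:ℕ)+1, by have := i.isLt; omega⟩
/-- Vertex `2i` (second friend of blade `i`). -/
def v2 {m : ℕ} (i : Fin m) : Fin (2*m+1) := ⟨2*(i:ℕ)+2, by have := i.isLt; omega⟩

/-- Edge relation of the friendship graph `F_m`. -/
def IsEdge {m : ℕ} (a b : Fin (2*m+1)) : Prop :=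
  ∃ i : Fin m,
    ({a, b} : Set (Fin (2*m+1))) = {v0, v1 i} ∨
    ({a, b} : Set (Fin (2*m+1))) = {v0, v2 i} ∨
    ({a, b} : Set (Fin (2*m+1))) = {v1 i, v2 i}

/-- The vector `u_i = (1/π_{2i-1})·e_{2i-1} - (1/π_{2i})·e_{2i}` in `ℝ^{2m+1}`. -/
noncomputable def uvec {m : ℕ} (pr : Fin (2*m+1) → ℝ) (i : Fin m) : Fin (2*m+1) → ℝ :=
  (1 / pr (v1 i)) • (Pi.single (v1 i) (1:ℝ) : Fin (2*m+1) → ℝ)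
    - (1 / pr (v2 i)) • (Pi.single (v2 i) (1:ℝ) : Fin (2*m+1) → ℝ)

lemma v0_ne_v1 {m : ℕ} (i : Fin m) : (v0 : Fin (2*m+1)) ≠ v1 i := by
  simp [v0, v1, Fin.ext_iff]

lemma v0_ne_v2 {m : ℕ} (i : Fin m) : (v0 : Fin (2*m+1)) ≠ v2 i := by
  simp [v0, v2, Fin.ext_iff]

lemma v1_ne_v2 {m : ℕ} (i : Fin m) : v1 i ≠ v2 i := by
  simp [v1, v2, Fin.ext_iff]

/-- The neighbours of `v1 i` are the centre and `v2 i`. -/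
lemma IsEdge.eq_of_v1 {m : ℕ} {i : Fin m} {b : Fin (2*m+1)} (h : IsEdge (v1 i) b) :
    b = v0 ∨ b = v2 i := by
  obtain ⟨j, h⟩ := h
  simp only [Set.pair_eq_pair_iff, v0, v1, v2, Fin.ext_iff] at h ⊢
  omega

/-- The neighbours of `v2 i` are the centre and `v1 i`. -/
lemma IsEdge.eq_of_v2 {m : ℕ} {i : Fin m} {b : Fin (2*m+1)} (h : IsEdge (v2 i) b) :
    b = v0 ∨ b = v1 i := by
  obtain ⟨j, h⟩ := h
  simp only [Set.pair_eq_pair_iff, v0, v1, v2, Fin.ext_iff] at h ⊢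
  omega

lemma lap_apply_of_ne {n : ℕ} (q : Fin n → Fin n → ℝ) {a b : Fin n} (h : a ≠ b) :
    lap q a b = -q a b := by
  simp [lap, h]

/-- The diagonal entry of the Laplacian at a vertex whose only neighbours are `b` and `c`. -/
lemma lap_apply_self_of_two_neighbors {n : ℕ} (q : Fin n → Fin n → ℝ) {a b c : Fin n}
    (hab : a ≠ b) (hac : a ≠ c) (hbc : b ≠ c)
    (h : ∀ k, k ≠ b → k ≠ c → q a k = 0) : lap q a a = q a b + q a c := by
  simp only [lap, Matrix.of_apply, if_true]
  rw [← Finset.sum_pair hbc]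
  symm
  apply Finset.sum_subset
  · intro k hk
    simp only [Finset.mem_insert, Finset.mem_singleton] at hk
    rcases hk with rfl | rfl <;> simp [hab.symm, hac.symm]
  · intro k _ hk
    simp only [Finset.mem_insert, Finset.mem_singleton, not_or] at hk
    exact h k hk.1 hk.2

lemma transP_mulVec_apply {n : ℕ} (pr : Fin n → ℝ) (hpr : ∀ v, 0 < pr v)
    (q : Fin n → Fin n → ℝ) (u : Fin n → ℝ) (a : Fin n) :
    (transP pr q).mulVec u a = u a - (pr a)⁻¹ * (lap q).mulVec u a := by
  have hinv : (Matrix.diagonal pr)⁻¹ = Matrix.diagonal fun v => (pr v)⁻¹ := by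
    apply Matrix.inv_eq_right_inv
    rw [Matrix.diagonal_mul_diagonal, ← Matrix.diagonal_one]
    congr 1
    funext v
    exact mul_inv_cancel₀ (hpr v).ne'
  rw [transP, hinv, Matrix.sub_mulVec, Matrix.one_mulVec, ← Matrix.mulVec_mulVec,
    Pi.sub_apply, Matrix.mulVec_diagonal]

lemma mulVec_uvec_apply {m : ℕ} (M : Matrix (Fin (2*m+1)) (Fin (2*m+1)) ℝ)
    (pr : Fin (2*m+1) → ℝ) (i : Fin m) (a : Fin (2*m+1)) :
    M.mulVec (uvec pr i) a = M a (v1 i) / pr (v1 i) - M a (v2 i) / pr (v2 i) := by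
  simp [uvec, Matrix.mulVec_sub, Matrix.mulVec_smul, div_eq_inv_mul]

lemma uvec_apply_v1 {m : ℕ} (pr : Fin (2*m+1) → ℝ) (i : Fin m) :
    uvec pr i (v1 i) = 1 / pr (v1 i) := by
  simp [uvec, v1_ne_v2]

lemma uvec_apply_v2 {m : ℕ} (pr : Fin (2*m+1) → ℝ) (i : Fin m) :
    uvec pr i (v2 i) = -(1 / pr (v2 i)) := by
  simp [uvec, (v1_ne_v2 i).symm]

lemma uvec_apply_of_ne {m : ℕ} (pr : Fin (2*m+1) → ℝ) (i : Fin m) {a : Fin (2*m+1)}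
    (h1 : a ≠ v1 i) (h2 : a ≠ v2 i) : uvec pr i a = 0 := by
  simp [uvec, h1, h2]

/-- Under the ratio condition, for each blade `i` the vector
`u_i = (1/π_{2i-1})·e_{2i-1} - (1/π_{2i})·e_{2i}` is an eigenvector of `P` with
eigenvalue `s̄_i = 1 - μ_i - q_{2i-1,2i}(π_{2i-1}+π_{2i})/(π_{2i-1}π_{2i})`. -/
theorem stmt_2 {m : ℕ} (hm : 1 ≤ m)
    (pr : Fin (2*m+1) → ℝ) (hpr : ∀ v, 0 < pr v)
    (q : Fin (2*m+1) → Fin (2*m+1) → ℝ)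
    (hsymm : ∀ a b, q a b = q b a)
    (hqnn : ∀ a b, 0 ≤ q a b)
    (hedge : ∀ a b, ¬ IsEdge a b → q a b = 0)
    (μ : Fin m → ℝ)
    (hratio : ∀ i : Fin m,
      μ i = q v0 (v1 i) / pr (v1 i) ∧ μ i = q v0 (v2 i) / pr (v2 i)) :
    ∀ i : Fin m,
      uvec pr i ≠ 0 ∧
      (transP pr q).mulVec (uvec pr i)
        = (1 - μ i - q (v1 i) (v2 i) * (pr (v1 i) + pr (v2 i))
              / (pr (v1 i) * pr (v2 i))) • uvec pr i := by
  intro i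
  have h1 := hpr (v1 i)
  have h2 := hpr (v2 i)
  have n1 := h1.ne'
  have n2 := h2.ne'
  have z1 : ∀ k, k ≠ v0 → k ≠ v2 i → q (v1 i) k = 0 := fun k hk hk' =>
    hedge _ _ fun h => h.eq_of_v1.elim hk hk'
  have z2 : ∀ k, k ≠ v0 → k ≠ v1 i → q (v2 i) k = 0 := fun k hk hk' =>
    hedge _ _ fun h => h.eq_of_v2.elim hk hk'
  obtain ⟨r1, r2⟩ := hratio i
  have e1 : q v0 (v1 i) = μ i * pr (v1 i) := by rw [r1]; field_simp
  have e2 : q v0 (v2 i) = μ i * pr (v2 i) := by rw [r2]; field_simp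
  refine ⟨fun h => ?_, ?_⟩
  · have h' := congrFun h (v1 i)
    rw [uvec_apply_v1] at h'
    exact (one_div_pos.mpr h1).ne' h'
  funext a
  rw [transP_mulVec_apply pr hpr, mulVec_uvec_apply, Pi.smul_apply, smul_eq_mul]
  by_cases ha1 : a = v1 i
  · subst ha1
    rw [lap_apply_self_of_two_neighbors q (v0_ne_v1 i).symm (v1_ne_v2 i) (v0_ne_v2 i) z1,
      lap_apply_of_ne q (v1_ne_v2 i), uvec_apply_v1, hsymm (v1 i) v0, e1]
    field_simp
    ring
  by_cases ha2 : a = v2 i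
  · subst ha2
    rw [lap_apply_self_of_two_neighbors q (v0_ne_v2 i).symm (v1_ne_v2 i).symm (v0_ne_v1 i) z2,
      lap_apply_of_ne q (v1_ne_v2 i).symm, uvec_apply_v2, hsymm (v2 i) v0,
      hsymm (v2 i) (v1 i), e2]
    field_simp
    ring
  rw [uvec_apply_of_ne pr i ha1 ha2, lap_apply_of_ne q ha1, lap_apply_of_ne q ha2]
  by_cases ha0 : a = v0
  · subst ha0
    rw [e1, e2]
    field_simp
    ring
  · rw [hsymm a, hsymm a, z1 a ha0 ha2, z2 a ha0 ha1]
    simp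
end

section
/- Fix m ≥ 1 and let P = I − D^{−1}L(q) be the reversible transition matrix on the friendship graph F_m, and assume the ratio condition μ_i = q_{0,2i−1}/π_{2i−1} = q_{0,2i}/π_{2i} for i = 1,…,m. Let P_S = I − D_S^{−1}L_S be the star transition matrix on {0,…,m} defined by π̃_0 = π_0, π̃_i = π_{2i−1}+π_{2i}, q̃_{0,i} = q_{0,2i−1}+q_{0,2i}, and set s̄_i = 1 − μ_i − q_{2i−1,2i}·(π_{2i−1}+π_{2i})/(π_{2i−1}·π_{2i}). Then the characteristic polynomial of P factors as charpoly(P) = charpoly(P_S) · ∏_{i=1}^{m} (X − s̄_i); in particular the spectrum of P (with multiplicity) is the union of the spectrum of P_S and the multiset {s̄_1,…,s̄_m}. -/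
open Matrix Polynomial

/-- Central vertex of the star on `{0,…,m}`. -/
def sv0 {m : ℕ} : Fin (m+1) := 0
/-- Leaf `i` of the star (for `i` in `Fin m`). -/
def sv {m : ℕ} (i : Fin m) : Fin (m+1) := i.succ

/-- Edge relation of the star on `{0,…,m}` with edges `{0, i}`. -/
def IsStarEdge {m : ℕ} (a b : Fin (m+1)) : Prop :=
  ∃ i : Fin m, ({a, b} : Set (Fin (m+1))) = {sv0, sv i}

theorem sum_univ_friendship {m : ℕ} {M : Type*} [AddCommMonoid M] (f : Fin (2*m+1) → M) :
    ∑ x, f x = f v0 + ∑ i : Fin m, (f (v1 i) + f (v2 i)) := by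
  induction m with
  | zero => simp [v0]
  | succ m ih =>
    change ∑ x : Fin (2*m+1+1+1), f x = _
    rw [Fin.sum_univ_castSucc, Fin.sum_univ_castSucc,
      ih (fun x => f x.castSucc.castSucc), Fin.sum_univ_castSucc (n := m), add_assoc, add_assoc]
    rfl

theorem vertex_cases {m : ℕ} (x : Fin (2*m+1)) :
    x = v0 ∨ ∃ i : Fin m, x = v1 i ∨ x = v2 i := by
  obtain ⟨x, hx⟩ := x
  rcases Nat.eq_zero_or_pos x with rfl | h
  · exact Or.inl rfl
  · refine Or.inr ⟨⟨(x - 1) / 2, by omega⟩, ?_⟩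
    simp only [v1, v2, Fin.ext_iff]
    omega

theorem not_isEdge_v1_v1 {m : ℕ} {i j : Fin m} : ¬ IsEdge (v1 i) (v1 j) := by
  rintro ⟨k, hk⟩
  simp only [Set.pair_eq_pair_iff, v0, v1, v2, Fin.ext_iff] at hk
  omega

theorem not_isEdge_v2_v2 {m : ℕ} {i j : Fin m} : ¬ IsEdge (v2 i) (v2 j) := by
  rintro ⟨k, hk⟩
  simp only [Set.pair_eq_pair_iff, v0, v1, v2, Fin.ext_iff] at hk
  omega

theorem not_isEdge_v1_v2 {m : ℕ} {i j : Fin m} (h : i ≠ j) : ¬ IsEdge (v1 i) (v2 j) := by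
  rintro ⟨k, hk⟩
  simp only [Set.pair_eq_pair_iff, v0, v1, v2, Fin.ext_iff, ne_eq] at hk h
  omega

theorem not_isStarEdge_sv_sv {m : ℕ} {i j : Fin m} : ¬ IsStarEdge (sv i) (sv j) := by
  rintro ⟨k, hk⟩
  simp [Set.pair_eq_pair_iff, sv, sv0] at hk

theorem lap_mulVec_apply {n : ℕ} (q : Fin n → Fin n → ℝ) (f : Fin n → ℝ) (x : Fin n) :
    (lap q *ᵥ f) x = ∑ y, q x y * (f x - f y) := by
  rw [mulVec, dotProduct, ← Finset.add_sum_erase _ _ (Finset.mem_univ x),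
    ← Finset.add_sum_erase _ (fun y => q x y * (f x - f y)) (Finset.mem_univ x)]
  have h : ∀ y ∈ Finset.univ.erase x, lap q x y * f y = -(q x y * f y) := fun y hy => by
    simp [lap, (Finset.ne_of_mem_erase hy).symm]
  rw [Finset.sum_congr rfl h]
  simp only [lap, of_apply, if_true, sub_self, mul_zero, zero_add, mul_sub, Finset.sum_mul,
    Finset.sum_sub_distrib, Finset.sum_neg_distrib, ← sub_eq_add_neg]

theorem transP_mulVec_apply_s3 {n : ℕ} {pr : Fin n → ℝ} (hpr : ∀ x, pr x ≠ 0)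
    (q : Fin n → Fin n → ℝ) (f : Fin n → ℝ) (x : Fin n) :
    (transP pr q *ᵥ f) x = f x - (∑ y, q x y * (f x - f y)) / pr x := by
  have hinv : (diagonal pr)⁻¹ = diagonal fun y => (pr y)⁻¹ :=
    inv_eq_right_inv (by simp [hpr, diagonal_mul_diagonal])
  rw [transP, hinv, sub_mulVec, one_mulVec, ← mulVec_mulVec, Pi.sub_apply, mulVec_diagonal,
    lap_mulVec_apply, div_eq_inv_mul]

/-- Averages over the blades (and the value at the centre), paired with the differences across
the blades. -/
noncomputable def bladeCoords {m : ℕ} (pr : Fin (2*m+1) → ℝ) :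
    (Fin (2*m+1) → ℝ) →ₗ[ℝ] (Fin (m+1) → ℝ) × (Fin m → ℝ) where
  toFun f := (Fin.cons (f v0) fun i =>
      (pr (v1 i) * f (v1 i) + pr (v2 i) * f (v2 i)) / (pr (v1 i) + pr (v2 i)),
    fun i => f (v1 i) - f (v2 i))
  map_add' f g := by
    refine Prod.ext (funext fun x => ?_) (funext fun i => ?_)
    · refine Fin.cases ?_ (fun i => ?_) x
      · simp
      · simp; ring
    · simp; ring
  map_smul' c f := by
    refine Prod.ext (funext fun x => ?_) (funext fun i => ?_)
    · refine Fin.cases ?_ (fun i => ?_) x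
      · simp
      · simp; ring
    · simp; ring

theorem bladeCoords_injective {m : ℕ} {pr : Fin (2*m+1) → ℝ} (hpr : ∀ v, 0 < pr v) :
    Function.Injective (bladeCoords pr) := by
  rw [← LinearMap.ker_eq_bot, LinearMap.ker_eq_bot']
  intro f hf
  have h0 : f v0 = 0 := congrFun (congrArg Prod.fst hf) 0
  have hi (i : Fin m) : f (v1 i) = 0 ∧ f (v2 i) = 0 := by
    have ha : (pr (v1 i) * f (v1 i) + pr (v2 i) * f (v2 i)) / (pr (v1 i) + pr (v2 i)) = 0 :=
      congrFun (congrArg Prod.fst hf) i.succ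
    have hd : f (v1 i) - f (v2 i) = 0 := congrFun (congrArg Prod.snd hf) i
    have hs : 0 < pr (v1 i) + pr (v2 i) := add_pos (hpr _) (hpr _)
    rw [div_eq_zero_iff, or_iff_left hs.ne', sub_eq_zero.mp hd, ← add_mul, mul_eq_zero,
      or_iff_right hs.ne'] at ha
    exact ⟨(sub_eq_zero.mp hd).trans ha, ha⟩
  funext x
  rcases vertex_cases x with rfl | ⟨i, rfl | rfl⟩
  exacts [h0, (hi i).1, (hi i).2]

/-- Under the ratio condition, the characteristic polynomial of the
friendship transition matrix `P` factors as the characteristic polynomial of the star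
transition matrix `P_S` times `∏ i (X - s̄_i)`; in particular the spectrum of `P`
(with multiplicity) is the union of the spectrum of `P_S` and `{s̄_1, …, s̄_m}`. -/
theorem stmt_3 {m : ℕ} (hm : 1 ≤ m)
    (pr : Fin (2*m+1) → ℝ) (hpr : ∀ v, 0 < pr v)
    (q : Fin (2*m+1) → Fin (2*m+1) → ℝ)
    (hsymm : ∀ a b, q a b = q b a)
    (hqnn : ∀ a b, 0 ≤ q a b)
    (hedge : ∀ a b, ¬ IsEdge a b → q a b = 0)
    (μ : Fin m → ℝ)
    (hratio : ∀ i : Fin m,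
      μ i = q v0 (v1 i) / pr (v1 i) ∧ μ i = q v0 (v2 i) / pr (v2 i))
    (prS : Fin (m+1) → ℝ) (qS : Fin (m+1) → Fin (m+1) → ℝ)
    (hprS0 : prS sv0 = pr v0)
    (hprSi : ∀ i : Fin m, prS (sv i) = pr (v1 i) + pr (v2 i))
    (hqSsymm : ∀ a b, qS a b = qS b a)
    (hqSe : ∀ i : Fin m, qS sv0 (sv i) = q v0 (v1 i) + q v0 (v2 i))
    (hqS0 : ∀ a b, ¬ IsStarEdge a b → qS a b = 0)
    (sbar : Fin m → ℝ)
    (hsbar : ∀ i : Fin m, sbar i =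
      1 - μ i - q (v1 i) (v2 i) * (pr (v1 i) + pr (v2 i)) / (pr (v1 i) * pr (v2 i))) :
    (transP pr q).charpoly
        = (transP prS qS).charpoly * ∏ i : Fin m, (X - C (sbar i)) ∧
      (transP pr q).charpoly.roots
        = (transP prS qS).charpoly.roots + Multiset.map sbar Finset.univ.val := by
  have hne v : pr v ≠ 0 := (hpr v).ne'
  have hs (i : Fin m) : pr (v1 i) + pr (v2 i) ≠ 0 := (add_pos (hpr _) (hpr _)).ne'
  have hneS v : prS v ≠ 0 := by
    refine Fin.cases ?_ (fun i => ?_) v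
    · exact hprS0 ▸ hne v0
    · exact hprSi i ▸ hs i
  have hq1 (i : Fin m) : q v0 (v1 i) = μ i * pr (v1 i) := by
    rw [(hratio i).1, div_mul_cancel₀ _ (hne _)]
  have hq2 (i : Fin m) : q v0 (v2 i) = μ i * pr (v2 i) := by
    rw [(hratio i).2, div_mul_cancel₀ _ (hne _)]
  have hP0 (f : Fin (2*m+1) → ℝ) : (transP pr q *ᵥ f) v0 = f v0 - (∑ i : Fin m,
      (μ i * pr (v1 i) * (f v0 - f (v1 i)) + μ i * pr (v2 i) * (f v0 - f (v2 i)))) / pr v0 := by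
    simp [transP_mulVec_apply_s3 hne, sum_univ_friendship, hq1, hq2]
  have hP1 (f : Fin (2*m+1) → ℝ) (i : Fin m) : (transP pr q *ᵥ f) (v1 i) = f (v1 i) -
      (μ i * pr (v1 i) * (f (v1 i) - f v0) + q (v1 i) (v2 i) * (f (v1 i) - f (v2 i)))
        / pr (v1 i) := by
    rw [transP_mulVec_apply_s3 hne, sum_univ_friendship, hsymm _ v0, hq1, Finset.sum_eq_single i]
    · simp [hedge _ _ not_isEdge_v1_v1]
    · intro j _ hj
      simp [hedge _ _ not_isEdge_v1_v1, hedge _ _ (not_isEdge_v1_v2 hj.symm)]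
    · simp
  have hP2 (f : Fin (2*m+1) → ℝ) (i : Fin m) : (transP pr q *ᵥ f) (v2 i) = f (v2 i) -
      (μ i * pr (v2 i) * (f (v2 i) - f v0) + q (v1 i) (v2 i) * (f (v2 i) - f (v1 i)))
        / pr (v2 i) := by
    rw [transP_mulVec_apply_s3 hne, sum_univ_friendship, hsymm _ v0, hq2, Finset.sum_eq_single i]
    · simp [hedge _ _ not_isEdge_v2_v2, hsymm (v2 i) (v1 i)]
    · intro j _ hj
      simp [hedge _ _ not_isEdge_v2_v2, hsymm (v2 i) (v1 j), hedge _ _ (not_isEdge_v1_v2 hj)]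
    · simp
  have hS0 (g : Fin (m+1) → ℝ) : (transP prS qS *ᵥ g) 0 = g 0 - (∑ i : Fin m,
      μ i * (pr (v1 i) + pr (v2 i)) * (g 0 - g i.succ)) / pr v0 := by
    rw [transP_mulVec_apply_s3 hneS, Fin.sum_univ_succ, sub_self, mul_zero, zero_add]
    congr 2
    refine Finset.sum_congr rfl fun i _ => ?_
    rw [show qS 0 i.succ = _ from hqSe i, hq1, hq2, mul_add]
  have hSi (g : Fin (m+1) → ℝ) (i : Fin m) : (transP prS qS *ᵥ g) i.succ = g i.succ -
      μ i * (g i.succ - g 0) := by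
    have hz (j : Fin m) : qS i.succ j.succ = 0 := hqS0 _ _ not_isStarEdge_sv_sv
    rw [transP_mulVec_apply_s3 hneS, Fin.sum_univ_succ, hqSsymm i.succ 0,
      show qS 0 i.succ = _ from hqSe i, show prS i.succ = _ from hprSi i, hq1, hq2]
    simp only [hz, zero_mul, Finset.sum_const_zero, add_zero]
    have := hs i
    field_simp
  let Φ := LinearMap.linearEquivOfInjective (bladeCoords pr) (bladeCoords_injective hpr)
    (by simp; ring)
  have hconj : Φ.conj (toLin' (transP pr q)) =
      (toLin' (transP prS qS)).prodMap (toLin' (diagonal sbar)) := by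
    rw [LinearEquiv.conj_apply, LinearEquiv.comp_toLinearMap_symm_eq]
    refine LinearMap.ext fun f => ?_
    change bladeCoords pr (transP pr q *ᵥ f) =
      (transP prS qS *ᵥ (bladeCoords pr f).1, diagonal sbar *ᵥ (bladeCoords pr f).2)
    refine Prod.ext (funext fun x => ?_) (funext fun i => ?_)
    · refine Fin.cases ?_ (fun i => ?_) x
      · simp only [hS0]
        simp only [bladeCoords, LinearMap.coe_mk, AddHom.coe_mk, Fin.cons_zero, Fin.cons_succ, hP0]
        congr 2
        refine Finset.sum_congr rfl fun i _ => ?_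
        have := hs i
        field_simp
        ring
      · simp only [hSi]
        simp only [bladeCoords, LinearMap.coe_mk, AddHom.coe_mk, Fin.cons_zero, Fin.cons_succ,
          hP1, hP2]
        have := hs i
        have := hne (v1 i)
        have := hne (v2 i)
        field_simp
        ring
    · simp only [mulVec_diagonal]
      simp only [bladeCoords, LinearMap.coe_mk, AddHom.coe_mk, hP1, hP2, hsbar]
      have := hne (v1 i)
      have := hne (v2 i)
      field_simp
      ring
  have hchar : (transP pr q).charpoly =
      (transP prS qS).charpoly * ∏ i : Fin m, (X - C (sbar i)) := by
    rw [← charpoly_toLin', ← LinearEquiv.charpoly_conj Φ, hconj, LinearMap.charpoly_prodMap,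
      charpoly_toLin', charpoly_toLin', charpoly_diagonal]
  have hprod : ∏ i : Fin m, (X - C (sbar i)) =
      (Multiset.map (fun a => X - C a) (Multiset.map sbar Finset.univ.val)).prod := by
    rw [Multiset.map_map]
    rfl
  refine ⟨hchar, ?_⟩
  rw [hchar, roots_mul, hprod, roots_multiset_prod_X_sub_C]
  exact mul_ne_zero (charpoly_monic _).ne_zero (monic_prod_X_sub_C _ _).ne_zero
end
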